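/- Let d ≥ 2 be an even integer, let h be a binomial random variable with parameters d and 1/2, and let Y = min(h, d − h). Then E[Y] = (d/2^d)·(2^{d−1} − binom(d−1, d/2)). -/

import Mathlib

/-- The number of heads among `d` fair coin flips `σ`. -/
def numHeads {d : ℕ} (σ : Fin d → Bool) : ℕ :=
  (Finset.univ.filter (fun j : Fin d => σ j = true)).card

/-- `minorityExp d` is the expectation of `Y = min(h, d−h)`, where `h` is a binomial
random variable with parameters `d` and `1/2` (the number of heads among `d`
independent fair coin flips). -/
noncomputable def minorityExp (d : ℕ) : ℝ :=
  (∑ σ : Fin d → Bool, ((min (numHeads σ) (d - numHeads σ) : ℕ) : ℝ)) / 2 ^ d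

/-- A sum over coin flips of a function of the number of heads, grouped by that number. -/
theorem sum_numHeads {M : Type*} [AddCommMonoid M] (d : ℕ) (f : ℕ → M) :
    ∑ σ : Fin d → Bool, f (numHeads σ) = ∑ k ∈ Finset.range (d + 1), d.choose k • f k := by
  have h := Finset.sum_powerset_apply_card f (x := (Finset.univ : Finset (Fin d)))
  rw [Finset.card_univ, Fintype.card_fin, Finset.powerset_univ] at h
  rw [← h]
  refine Finset.sum_bij' (fun σ _ => Finset.univ.filter (fun j => σ j = true))
    (fun s _ => fun j => decide (j ∈ s)) ?_ ?_ ?_ ?_ ?_ <;> simp [numHeads]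

/-- The partial sums of `k * C(N+1, k)` reduce to partial sums of `C(N, k)`. -/
theorem sum_range_succ_choose_mul (N r : ℕ) :
    ∑ k ∈ Finset.range (r + 1), (N + 1).choose k * k =
      (N + 1) * ∑ k ∈ Finset.range r, N.choose k := by
  rw [Finset.sum_range_succ', Finset.mul_sum, mul_zero, add_zero]
  exact Finset.sum_congr rfl fun k _ => (Nat.add_one_mul_choose_eq N k).symm

theorem sum_choose_mul_min (n : ℕ) :
    ∑ k ∈ Finset.range (2 * n + 3), (2 * n + 2).choose k * min k (2 * n + 2 - k) +
      (2 * n + 2) * (2 * n + 1).choose (n + 1) = (2 * n + 2) * 2 ^ (2 * n + 1) := by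
  have lower : ∑ k ∈ Finset.range (n + 2), (2 * n + 2).choose k * min k (2 * n + 2 - k) =
      (2 * n + 2) * ∑ k ∈ Finset.range (n + 1), (2 * n + 1).choose k := by
    rw [← sum_range_succ_choose_mul]
    refine Finset.sum_congr rfl fun k hk => ?_
    rw [Finset.mem_range] at hk
    rw [min_eq_left (by omega)]
  have upper : ∑ k ∈ Finset.range (n + 1),
      (2 * n + 2).choose (n + 2 + k) * min (n + 2 + k) (2 * n + 2 - (n + 2 + k)) =
      (2 * n + 2) * ∑ k ∈ Finset.range n, (2 * n + 1).choose k := by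
    rw [← sum_range_succ_choose_mul, ← Finset.sum_range_reflect]
    refine Finset.sum_congr rfl fun k hk => ?_
    rw [Finset.mem_range] at hk
    rw [min_eq_right (by omega), ← Nat.choose_symm (by omega : k ≤ 2 * n + 1 + 1)]
    congr 2 <;> omega
  have half := Nat.sum_range_choose_halfway n
  have symm : (2 * n + 1).choose (n + 1) = (2 * n + 1).choose n :=
    Nat.choose_symm_half n
  rw [show 2 * n + 3 = (n + 2) + (n + 1) by ring, Finset.sum_range_add, lower, upper, symm,
    ← mul_add, ← mul_add, add_assoc, ← Finset.sum_range_succ, half, pow_succ, pow_mul]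
  ring

/-- For even `d ≥ 2`, `E[Y] = (d/2^d)·(2^{d−1} − C(d−1, d/2))` where `Y = min(h, d−h)`
and `h ~ Bin(d, 1/2)`. -/
theorem minority_expectation_even (d : ℕ) (hd : 2 ≤ d) (hev : Even d) :
    minorityExp d = ((d : ℝ) / 2 ^ d) * (2 ^ (d - 1) - ((d - 1).choose (d / 2) : ℝ)) := by
  obtain ⟨n, rfl⟩ : ∃ n, d = 2 * n + 2 := by
    obtain ⟨m, rfl⟩ := hev
    exact ⟨m - 1, by omega⟩
  have key := congrArg (Nat.cast (R := ℝ)) (sum_choose_mul_min n)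
  rw [minorityExp,
    sum_numHeads (2 * n + 2) fun k => ((min k (2 * n + 2 - k) : ℕ) : ℝ),
    show (2 * n + 2) / 2 = n + 1 by omega, show 2 * n + 2 - 1 = 2 * n + 1 by omega,
    div_mul_eq_mul_div]
  congr 1
  rw [mul_sub, eq_sub_iff_add_eq]
  simp only [nsmul_eq_mul]
  exact_mod_cast key
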